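/- Ordered disjunction does not left-distribute a regular disjunction: for distinct atoms f, g, h, the theory {(f ∨ g) × h, h} has exactly three equilibrium models, with T ranging over {f,h}, {g,h} and {h}, whereas the theory {(f × h) ∨ (g × h), h} has exactly one equilibrium model, ⟨{h},{h}⟩. In particular (f ∨ g) × h and (f × h) ∨ (g × h) are not HT-equivalent. -/

import Mathlib

inductive Form (α : Type) : Type
  | atom : α → Form α
  | fls  : Form α
  | and  : Form α → Form α → Form α
  | or   : Form α → Form α → Form α
  | imp  : Form α → Form α → Form α

namespace Form

variable {α : Type}

/-- ¬F abbreviates F → ⊥ -/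
def neg (F : Form α) : Form α := imp F fls

/-- ⊤ abbreviates ⊥ → ⊥ -/
def tru : Form α := imp fls fls

/-- ordered disjunction F × G := F ∨ (¬F ∧ G) -/
def ox (F G : Form α) : Form α := or F (and (neg F) G)

/-- classical satisfaction -/
def csat (T : Set α) : Form α → Prop
  | atom p  => p ∈ T
  | fls     => False
  | and F G => csat T F ∧ csat T G
  | or F G  => csat T F ∨ csat T G
  | imp F G => csat T F → csat T G

/-- here-and-there satisfaction (for interpretations ⟨H,T⟩ with H ⊆ T) -/
def htsat (H T : Set α) : Form α → Prop
  | atom p  => p ∈ H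
  | fls     => False
  | and F G => htsat H T F ∧ htsat H T G
  | or F G  => htsat H T F ∨ htsat H T G
  | imp F G => (csat T F → csat T G) ∧ (¬ htsat H T F ∨ htsat H T G)

end Form

/-- HT-equivalence: satisfied by exactly the same HT-interpretations -/
def HTEquiv {α : Type} (F G : Form α) : Prop :=
  ∀ H T : Set α, H ⊆ T → (Form.htsat H T F ↔ Form.htsat H T G)

/-- ⟨T,T⟩ is an equilibrium model of the theory Γ -/
def EqModel {α : Type} (Γ : Set (Form α)) (T : Set α) : Prop :=
  (∀ F ∈ Γ, Form.htsat T T F) ∧ ∀ H : Set α, H ⊂ T → ¬ (∀ F ∈ Γ, Form.htsat H T F)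

/-- iterated ordered disjunction, associated to the left; ⊥ when empty -/
def oxList {α : Type} : List (Form α) → Form α
  | []      => Form.fls
  | a :: as => as.foldl Form.ox a

/-- iterated disjunction, associated to the left; ⊥ when empty -/
def orList {α : Type} : List (Form α) → Form α
  | []      => Form.fls
  | a :: as => as.foldl Form.or a

/-- iterated conjunction, associated to the left; ⊤ when empty -/
def andList {α : Type} : List (Form α) → Form α
  | []      => Form.tru
  | a :: as => as.foldl Form.and a

open Form

theorem htsat_ox_atom_or_atom {α : Type} {f g h : α} {H T : Set α} (hHT : H ⊆ T) :
    htsat H T (ox (or (atom f) (atom g)) (atom h)) ↔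
      (f ∈ H ∨ g ∈ H) ∨ ((f ∉ T ∧ g ∉ T) ∧ h ∈ H) := by
  have hf := @hHT f
  have hg := @hHT g
  simp only [ox, neg, htsat, csat]
  tauto

theorem htsat_or_ox_atom {α : Type} {f g h : α} {H T : Set α} (hHT : H ⊆ T) :
    htsat H T (or (ox (atom f) (atom h)) (ox (atom g) (atom h))) ↔
      (f ∈ H ∨ (f ∉ T ∧ h ∈ H)) ∨ (g ∈ H ∨ (g ∉ T ∧ h ∈ H)) := by
  have hf := @hHT f
  have hg := @hHT g
  simp only [ox, neg, htsat, csat]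
  tauto

theorem eqModel_pair_iff {α : Type} {F G : Form α} {T : Set α} :
    EqModel {F, G} T ↔ (htsat T T F ∧ htsat T T G) ∧
      ∀ H ⊆ T, htsat H T F → htsat H T G → H = T := by
  simp only [EqModel, Set.mem_insert_iff, Set.mem_singleton_iff, forall_eq_or_imp, forall_eq]
  refine and_congr_right fun _ => ⟨fun hmin H hHT hF hG => ?_, fun hmin H hHT hFG => ?_⟩
  · by_contra hne
    exact hmin H (hHT.ssubset_of_ne hne) ⟨hF, hG⟩
  · exact hHT.ne (hmin H hHT.subset hFG.1 hFG.2)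

theorem eqModel_ox_or_iff {α : Type} {f g h : α} (hfg : f ≠ g) (hfh : f ≠ h) (hgh : g ≠ h)
    {T : Set α} :
    EqModel {ox (or (atom f) (atom g)) (atom h), atom h} T ↔
      T = {f, h} ∨ T = {g, h} ∨ T = {h} := by
  rw [eqModel_pair_iff, htsat_ox_atom_or_atom subset_rfl]
  constructor
  · rintro ⟨⟨hT, hh : h ∈ T⟩, hmin⟩
    by_cases hf : f ∈ T
    · have hs : ({f, h} : Set α) ⊆ T := Set.pair_subset hf hh
      exact .inl (hmin _ hs ((htsat_ox_atom_or_atom hs).2 (by simp)) (by simp [htsat])).symm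
    by_cases hg : g ∈ T
    · have hs : ({g, h} : Set α) ⊆ T := Set.pair_subset hg hh
      exact .inr (.inl (hmin _ hs ((htsat_ox_atom_or_atom hs).2 (by simp)) (by simp [htsat])).symm)
    · have hs : ({h} : Set α) ⊆ T := Set.singleton_subset_iff.2 hh
      exact .inr (.inr (hmin _ hs ((htsat_ox_atom_or_atom hs).2 (by simp [hf, hg]))
        (by simp [htsat])).symm)
  · rintro (rfl | rfl | rfl) <;>
      refine ⟨by simp [htsat, hfh, hgh], fun H hHT hF (hh : h ∈ H) => hHT.antisymm ?_⟩ <;>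
      rw [htsat_ox_atom_or_atom hHT] at hF
    · have hg : g ∉ H := fun hg => by simpa [hfg.symm, hgh] using hHT hg
      simp only [Set.mem_insert_iff, true_or, not_true_eq_false, false_and, or_false, hg] at hF
      exact Set.pair_subset hF hh
    · have hf : f ∉ H := fun hf => by simpa [hfg, hfh] using hHT hf
      simp only [Set.mem_insert_iff, true_or, not_true_eq_false, and_false, false_and, or_false,
        false_or, hf] at hF
      exact Set.pair_subset hF hh
    · exact Set.singleton_subset_iff.2 hh

theorem eqModel_or_ox_iff {α : Type} {f g h : α} (hfg : f ≠ g) (hfh : f ≠ h) (hgh : g ≠ h)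
    {T : Set α} :
    EqModel {or (ox (atom f) (atom h)) (ox (atom g) (atom h)), atom h} T ↔ T = {h} := by
  rw [eqModel_pair_iff, htsat_or_ox_atom subset_rfl]
  constructor
  · rintro ⟨⟨hT, hh : h ∈ T⟩, hmin⟩
    have hs : ({h} : Set α) ⊆ T := Set.singleton_subset_iff.2 hh
    by_cases hfgT : f ∈ T ∧ g ∈ T
    · have hp : ({f, h} : Set α) ⊆ T := Set.pair_subset hfgT.1 hh
      have hTp := hmin _ hp ((htsat_or_ox_atom hp).2 (by simp)) (by simp [htsat])
      have hg := hfgT.2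
      rw [← hTp] at hg
      simp [hfg.symm, hgh] at hg
    · refine (hmin _ hs ((htsat_or_ox_atom hs).2 ?_) (by simp [htsat])).symm
      simp only [Set.mem_singleton_iff]
      tauto
  · rintro rfl
    exact ⟨by simp [htsat, hfh, hgh], fun H hHT _ (hh : h ∈ H) =>
      hHT.antisymm (Set.singleton_subset_iff.2 hh)⟩

theorem ox_no_left_distrib_over_or {α : Type} (f g h : α)
    (hfg : f ≠ g) (hfh : f ≠ h) (hgh : g ≠ h) :
    ({T : Set α |
        EqModel {Form.ox (Form.or (Form.atom f) (Form.atom g)) (Form.atom h),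
                 Form.atom h} T} = {{f, h}, {g, h}, {h}}) ∧
    ({T : Set α |
        EqModel {Form.or (Form.ox (Form.atom f) (Form.atom h))
                         (Form.ox (Form.atom g) (Form.atom h)),
                 Form.atom h} T} = {{h}}) ∧
    ¬ HTEquiv (Form.ox (Form.or (Form.atom f) (Form.atom g)) (Form.atom h))
        (Form.or (Form.ox (Form.atom f) (Form.atom h))
                 (Form.ox (Form.atom g) (Form.atom h))) := by
  refine ⟨?_, ?_, fun hequiv => ?_⟩
  · ext T
    simp [eqModel_ox_or_iff hfg hfh hgh]
  · ext T
    simp [eqModel_or_ox_iff hfg hfh hgh]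
  · have hs : ({h} : Set α) ⊆ {f, h} := by simp
    have hiff := hequiv _ _ hs
    rw [htsat_ox_atom_or_atom hs, htsat_or_ox_atom hs] at hiff
    simp [hfg.symm, hfh, hgh] at hiff
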